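/- Let (R,m,k) be a commutative Noetherian local ring, let M and X be finitely generated R-modules with X ≠ 0, and let N be a submodule of X such that X/N has finite length. If t ≥ 1 is an integer such that Tor_t^R(M, X/mN) = 0 and Tor_t^R(M, X) = 0, then either depth_R(X) = 0 or the projective dimension of M is strictly less than t. -/

import Mathlib

open CategoryTheory

universe u

/-- The colon submodule `(N :_X I) = {x ∈ X : I • x ⊆ N}`. -/
def Submodule.colonBy {R X : Type u} [CommRing R] [AddCommGroup X] [Module R X]
    (N : Submodule R X) (I : Ideal R) : Submodule R X where
  carrier := {x | ∀ r ∈ I, r • x ∈ N}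
  add_mem' := by
    intro a b ha hb r hr
    rw [smul_add]
    exact N.add_mem (ha r hr) (hb r hr)
  zero_mem' := by
    intro r hr
    rw [smul_zero]
    exact N.zero_mem
  smul_mem' := by
    intro c x hx r hr
    rw [smul_comm]
    exact N.smul_mem c (hx r hr)

/-- A submodule `N` of a module `X` over a local ring `(R, 𝔪)` is *Burch* if
`𝔪 • (N :_X 𝔪) ≠ 𝔪 • N`. -/
def Submodule.IsBurch {R X : Type u} [CommRing R] [IsLocalRing R] [AddCommGroup X]
    [Module R X] (N : Submodule R X) : Prop :=
  IsLocalRing.maximalIdeal R • N.colonBy (IsLocalRing.maximalIdeal R) ≠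
    IsLocalRing.maximalIdeal R • N

/-- `Tor_n^R(M, N) = 0`. -/
def TorIsZero (R : Type u) [CommRing R] (M N : Type u) [AddCommGroup M] [Module R M]
    [AddCommGroup N] [Module R N] (n : ℕ) : Prop :=
  Subsingleton (((Tor (ModuleCat.{u} R) n).obj (ModuleCat.of R M)).obj (ModuleCat.of R N))

/-- `Ext^n_R(M, N) = 0`. -/
def ExtIsZero (R : Type u) [CommRing R] (M N : Type u) [AddCommGroup M] [Module R M]
    [AddCommGroup N] [Module R N] (n : ℕ) : Prop :=
  Subsingleton
    (((Ext R (ModuleCat.{u} R) n).obj (Opposite.op (ModuleCat.of R M))).obj (ModuleCat.of R N))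

/-- `M` has projective dimension strictly less than `t`, i.e. `M` admits a projective
resolution vanishing in all degrees `≥ t`. -/
def HasProjDimLT (R : Type u) [CommRing R] (M : Type u) [AddCommGroup M] [Module R M]
    (t : ℕ) : Prop :=
  ∃ P : ProjectiveResolution (ModuleCat.of R M), ∀ i, t ≤ i → Limits.IsZero (P.complex.X i)

/-- `M` has injective dimension strictly less than `t`, i.e. `M` admits an injective
resolution vanishing in all degrees `≥ t`. -/
def HasInjDimLT (R : Type u) [CommRing R] (M : Type u) [AddCommGroup M] [Module R M]
    (t : ℕ) : Prop :=
  ∃ I : InjectiveResolution (ModuleCat.of R M), ∀ i, t ≤ i → Limits.IsZero (I.cocomplex.X i)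

/-- The depth of a module `M` over a local ring `(R, 𝔪, k)`: the smallest `i` such that
`Ext^i_R(k, M) ≠ 0` (and `⊤` if no such `i` exists). -/
noncomputable def moduleDepth (R : Type u) [CommRing R] [IsLocalRing R] (M : Type u)
    [AddCommGroup M] [Module R M] : ℕ∞ :=
  sInf {n : ℕ∞ | ∃ i : ℕ, n = (i : ℕ∞) ∧ ¬ ExtIsZero R (IsLocalRing.ResidueField R) M i}

open TensorProduct IsLocalRing

theorem LinearMap.lTensor_rTensor_apply {R : Type*} [CommRing R] {F M A B : Type*}
    [AddCommGroup F] [Module R F] [AddCommGroup M] [Module R M] [AddCommGroup A] [Module R A]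
    [AddCommGroup B] [Module R B] (g : F →ₗ[R] M) (d : A →ₗ[R] B) (z : F ⊗[R] A) :
    d.lTensor M (g.rTensor A z) = g.rTensor B (d.lTensor F z) := by
  rw [← LinearMap.comp_apply, ← LinearMap.comp_apply, LinearMap.lTensor_comp_rTensor,
    LinearMap.rTensor_comp_lTensor]

/-- Dimension shifting, on elements: if `0 → K → F → M → 0` is exact, `A₂ → A₁ → A₀` is a complex
that stays exact after tensoring with `M`, and `A₀` is flat, then a boundary of `F ⊗ A` which
comes from `K ⊗ A₀` is a boundary of `K ⊗ A`. -/
theorem mem_range_lTensor_of_exact {R : Type*} [CommRing R]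
    {K F M A₂ A₁ A₀ : Type*} [AddCommGroup K] [Module R K] [AddCommGroup F] [Module R F]
    [AddCommGroup M] [Module R M] [AddCommGroup A₂] [Module R A₂] [AddCommGroup A₁] [Module R A₁]
    [AddCommGroup A₀] [Module R A₀] [Module.Flat R A₀]
    {i : K →ₗ[R] F} {p : F →ₗ[R] M} (hi : Function.Injective i) (hp : Function.Surjective p)
    (hip : Function.Exact i p)
    {d₂ : A₂ →ₗ[R] A₁} {d₁ : A₁ →ₗ[R] A₀} (hd : d₁ ∘ₗ d₂ = 0)
    (hM : Function.Exact (d₂.lTensor M) (d₁.lTensor M))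
    {x : K ⊗[R] A₀} {f : F ⊗[R] A₁} (hx : d₁.lTensor F f = i.rTensor A₀ x) :
    ∃ y, d₁.lTensor K y = x := by
  have hdF (z : F ⊗[R] A₂) : d₁.lTensor F (d₂.lTensor F z) = 0 := by
    rw [← LinearMap.comp_apply, ← LinearMap.lTensor_comp, hd, LinearMap.lTensor_zero,
      LinearMap.zero_apply]
  have hpx : p.rTensor A₀ (i.rTensor A₀ x) = 0 :=
    ((rTensor_exact A₀ hip hp) _).2 ⟨x, rfl⟩
  obtain ⟨m, hm⟩ := (hM (p.rTensor A₁ f)).1 (by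
    rw [LinearMap.lTensor_rTensor_apply, hx, hpx])
  obtain ⟨f', rfl⟩ := LinearMap.rTensor_surjective A₂ hp m
  obtain ⟨y, hy⟩ := ((rTensor_exact A₁ hip hp) (f - d₂.lTensor F f')).1 (by
    rw [map_sub, ← LinearMap.lTensor_rTensor_apply, hm, sub_self])
  refine ⟨y, Module.Flat.rTensor_preserves_injective_linearMap (M := A₀) i hi ?_⟩
  rw [← LinearMap.lTensor_rTensor_apply, hy, map_sub, hdF, hx, sub_zero]

theorem torIsZero_succ_iff_exact {R : Type u} [CommRing R] {M Y : Type u} [AddCommGroup M]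
    [Module R M] [AddCommGroup Y] [Module R Y] (P : ProjectiveResolution (ModuleCat.of R Y))
    (n : ℕ) :
    TorIsZero R M Y (n + 1) ↔
      Function.Exact ((P.complex.d (n + 2) (n + 1)).hom.lTensor M)
        ((P.complex.d (n + 1) n).hom.lTensor M) := by
  let T := (MonoidalCategory.tensoringLeft (ModuleCat.{u} R)).obj (ModuleCat.of R M)
  rw [TorIsZero, ← ModuleCat.isZero_iff_subsingleton]
  refine (P.isoLeftDerivedObj T (n + 1)).isZero_iff.trans ?_
  refine (HomologicalComplex.exactAt_iff_isZero_homology _ _).symm.trans ?_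
  rw [HomologicalComplex.exactAt_iff' _ (n + 2) (n + 1) n (by simp) (by simp),
    ShortComplex.ShortExact.moduleCat_exact_iff_function_exact]
  rfl

instance CategoryTheory.ProjectiveResolution.flat_X {R : Type u} [CommRing R]
    {Y : ModuleCat.{u} R} (P : ProjectiveResolution Y) (n : ℕ) :
    Module.Flat R (P.complex.X n) :=
  have : Module.Projective R (P.complex.X n) :=
    (IsProjective.iff_projective (P.complex.X n)).2 (P.projective n)
  inferInstance

section DimensionShift

variable {R : Type u} [CommRing R] {K F M Y : Type u} [AddCommGroup K] [Module R K]
  [AddCommGroup F] [Module R F] [AddCommGroup M] [Module R M]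
  [AddCommGroup Y] [Module R Y] {i : K →ₗ[R] F} {p : F →ₗ[R] M}

theorem TorIsZero.of_exact_of_flat [Module.Flat R F] (hi : Function.Injective i)
    (hp : Function.Surjective p) (hip : Function.Exact i p) {n : ℕ}
    (h : TorIsZero R M Y (n + 2)) : TorIsZero R K Y (n + 1) := by
  let P := ProjectiveResolution.of (ModuleCat.of R Y)
  rw [torIsZero_succ_iff_exact P] at h ⊢
  have hd (j : ℕ) : (P.complex.d (j + 1) j).hom ∘ₗ (P.complex.d (j + 2) (j + 1)).hom = 0 := by
    rw [← ModuleCat.hom_comp, P.complex.d_comp_d]; rfl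
  have hF : Function.Exact ((P.complex.d (n + 2) (n + 1)).hom.lTensor F)
      ((P.complex.d (n + 1) n).hom.lTensor F) :=
    Module.Flat.lTensor_exact F
      ((ShortComplex.ShortExact.moduleCat_exact_iff_function_exact _).1 (P.exact_succ n))
  intro x
  refine ⟨fun hx ↦ ?_, ?_⟩
  · obtain ⟨f, hf⟩ := (hF (i.rTensor _ x)).1 (by
      rw [LinearMap.lTensor_rTensor_apply, hx, map_zero])
    exact mem_range_lTensor_of_exact hi hp hip (hd (n + 1)) h hf
  · rintro ⟨y, rfl⟩
    rw [← LinearMap.comp_apply, ← LinearMap.lTensor_comp, hd, LinearMap.lTensor_zero,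
      LinearMap.zero_apply]

theorem TorIsZero.rTensor_injective (hi : Function.Injective i)
    (hp : Function.Surjective p) (hip : Function.Exact i p)
    (h : TorIsZero R M Y 1) : Function.Injective (i.rTensor Y) := by
  let P := ProjectiveResolution.of (ModuleCat.of R Y)
  rw [torIsZero_succ_iff_exact P] at h
  let ε : P.complex.X 0 →ₗ[R] Y := (P.π.f 0).hom
  have hε : Function.Surjective ε := (ModuleCat.epi_iff_surjective (P.π.f 0)).1 inferInstance
  have hdε : Function.Exact (P.complex.d 1 0).hom ε :=
    (ShortComplex.ShortExact.moduleCat_exact_iff_function_exact _).1 P.exact₀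
  rw [injective_iff_map_eq_zero]
  intro x hx
  obtain ⟨x, rfl⟩ := LinearMap.lTensor_surjective K hε x
  obtain ⟨f, hf⟩ := (lTensor_exact F hdε hε (i.rTensor _ x)).1 (by
    rw [LinearMap.lTensor_rTensor_apply, hx])
  have hd : (P.complex.d 1 0).hom ∘ₗ (P.complex.d 2 1).hom = 0 := by
    rw [← ModuleCat.hom_comp, P.complex.d_comp_d]; rfl
  exact (lTensor_exact K hdε hε x).2 (mem_range_lTensor_of_exact hi hp hip hd h hf)

end DimensionShift

theorem HasProjDimLT.of_projective {R : Type u} [CommRing R] {M : Type u} [AddCommGroup M]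
    [Module R M] [Module.Projective R M] : HasProjDimLT R M 1 := by
  have : Projective (ModuleCat.of R M) := (IsProjective.iff_projective M).1 inferInstance
  refine ⟨ProjectiveResolution.self _, fun i hi ↦ ?_⟩
  exact HomologicalComplex.isZero_single_obj_X _ _ _ _ (by omega)

theorem HasProjDimLT.of_exact {R : Type u} [CommRing R] {K F M : Type u} [AddCommGroup K]
    [Module R K] [AddCommGroup F] [Module R F] [Module.Projective R F] [AddCommGroup M]
    [Module R M] {i : K →ₗ[R] F} {p : F →ₗ[R] M} (hi : Function.Injective i)
    (hp : Function.Surjective p) (hip : Function.Exact i p) {n : ℕ} (h : HasProjDimLT R K n) :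
    HasProjDimLT R M (n + 1) := by
  obtain ⟨P, hP⟩ := h
  let f : P.complex.X 0 ⟶ ModuleCat.of R F := P.π.f 0 ≫ ModuleCat.ofHom i
  have hπ : Function.Surjective (P.π.f 0).hom :=
    (ModuleCat.epi_iff_surjective (P.π.f 0)).1 inferInstance
  have hdπ : Function.Exact (P.complex.d 1 0).hom (P.π.f 0).hom :=
    (ShortComplex.ShortExact.moduleCat_exact_iff_function_exact _).1 P.exact₀
  have w : P.complex.d 1 0 ≫ f = 0 := by
    ext x
    exact (congrArg i (hdπ.apply_apply_eq_zero x)).trans (map_zero i)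
  have hfp : f ≫ ModuleCat.ofHom p = 0 := by
    ext x
    exact hip.apply_apply_eq_zero _
  let C := P.complex.augment f w
  have hproj (j : ℕ) : Projective (C.X j) := by
    cases j with
    | zero => exact (IsProjective.iff_projective F).1 inferInstance
    | succ j => exact P.projective j
  let ε := (ChainComplex.toSingle₀Equiv C (ModuleCat.of R M)).symm ⟨ModuleCat.ofHom p, hfp⟩
  have hε (x : F) : (ε.f 0).hom x = p x :=
    LinearMap.congr_fun (congrArg ModuleCat.Hom.hom
      (ChainComplex.toSingle₀Equiv_symm_apply_f_zero (C := C) (ModuleCat.ofHom p) hfp)) x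
  refine ⟨{ complex := C
            projective := hproj
            π := ε
            quasiIso := ⟨fun j ↦ ?_⟩ }, fun j hj ↦ ?_⟩
  · cases j with
    | zero =>
      rw [ChainComplex.quasiIsoAt₀_iff, ShortComplex.quasiIso_iff_of_zeros' _ rfl rfl rfl]
      constructor
      · rw [ShortComplex.ShortExact.moduleCat_exact_iff_function_exact]
        intro x
        refine Iff.trans ?_ ((hip x).trans ?_)
        · exact ⟨(hε x).symm.trans, (hε x).trans⟩
        · refine ⟨?_, ?_⟩
          · rintro ⟨k, rfl⟩
            obtain ⟨y, rfl⟩ := hπ k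
            exact ⟨y, rfl⟩
          · rintro ⟨y, rfl⟩
            exact ⟨_, rfl⟩
      · rw [ModuleCat.epi_iff_surjective]
        intro m
        obtain ⟨x, rfl⟩ := hp m
        exact ⟨x, hε x⟩
    | succ j =>
      rw [quasiIsoAt_iff_exactAt' _ _ (ChainComplex.exactAt_succ_single_obj _ _),
        HomologicalComplex.exactAt_iff' _ (j + 2) (j + 1) j (by simp) (by simp),
        ShortComplex.ShortExact.moduleCat_exact_iff_function_exact]
      cases j with
      | zero =>
        intro x
        refine Iff.trans ?_ (hdπ x)
        exact (map_eq_zero_iff i hi)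
      | succ j =>
        exact (ShortComplex.ShortExact.moduleCat_exact_iff_function_exact _).1 (P.exact_succ j)
  · obtain ⟨j, rfl⟩ : ∃ k, j = k + 1 := ⟨j - 1, by omega⟩
    exact hP j (by omega)

/-- A finite module over a local ring has a free cover whose kernel lies in `𝔪Rⁿ`. -/
theorem exists_surjective_forall_mem_ker_mem_maximalIdeal {R M : Type*} [CommRing R] [IsLocalRing R]
    [AddCommGroup M] [Module R M] [Module.Finite R M] :
    ∃ (n : ℕ) (p : (Fin n → R) →ₗ[R] M), Function.Surjective p ∧
      ∀ c ∈ LinearMap.ker p, ∀ j, c j ∈ maximalIdeal R := by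
  let b := Module.finBasis (ResidueField R) (ResidueField R ⊗[R] M)
  choose v hv using fun j ↦ TensorProduct.mk_surjective R M (ResidueField R)
    residue_surjective (b j)
  refine ⟨_, Fintype.linearCombination R v, ?_, fun c hc j ↦ ?_⟩
  · rw [← LinearMap.range_eq_top, Fintype.range_linearCombination]
    exact span_eq_top_of_tmul_eq_basis v b hv
  · rw [LinearMap.mem_ker, Fintype.linearCombination_apply] at hc
    have h := congr_arg (TensorProduct.mk R (ResidueField R) M 1) hc
    have h' : ∑ j, residue R (c j) • b j = 0 := by
      rw [map_sum, map_zero] at h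
      rw [← h]
      refine Finset.sum_congr rfl fun j _ ↦ ?_
      rw [map_smul, hv]
      rfl
    exact (residue_eq_zero_iff _).1 (Fintype.linearIndependent_iff.1 b.linearIndependent _ h' j)

theorem IsFiniteLength.exists_maximalIdeal_pow_smul_top_eq_bot {R Q : Type*} [CommRing R]
    [IsLocalRing R] [AddCommGroup Q] [Module R Q] (h : IsFiniteLength R Q) :
    ∃ s : ℕ, maximalIdeal R ^ s • (⊤ : Submodule R Q) = ⊥ := by
  obtain ⟨_, _⟩ := isFiniteLength_iff_isNoetherian_isArtinian.1 h
  obtain ⟨s, hs⟩ := IsArtinian.monotone_stabilizes (R := R) (M := Q)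
    ⟨fun n ↦ OrderDual.toDual (maximalIdeal R ^ n • (⊤ : Submodule R Q)),
      fun a b hab ↦ Submodule.smul_mono_left (Ideal.pow_le_pow_right hab)⟩
  refine ⟨s, Submodule.eq_bot_of_le_smul_of_le_jacobson_bot (maximalIdeal R) _
    (IsNoetherian.noetherian _) ?_ (maximalIdeal_le_jacobson _)⟩
  have := hs (s + 1) s.le_succ
  rw [← Submodule.mul_smul, ← pow_succ']
  exact le_of_eq this

/-- A nonzero module killed by a power of `I` has a nonzero element killed by `I`. -/
theorem exists_ne_zero_smul_eq_zero_of_pow_smul_top_eq_bot {R Q : Type*} [CommRing R]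
    [AddCommMonoid Q] [Module R Q] [Nontrivial Q] (I : Ideal R) {s : ℕ}
    (h : I ^ s • (⊤ : Submodule R Q) = ⊥) : ∃ y : Q, y ≠ 0 ∧ ∀ r ∈ I, r • y = 0 := by
  induction s with
  | zero => simp at h
  | succ s ih =>
    by_cases h' : I ^ s • (⊤ : Submodule R Q) = ⊥
    · exact ih h'
    · obtain ⟨y, hy, hy0⟩ := Submodule.exists_mem_ne_zero_of_ne_bot h'
      refine ⟨y, hy0, fun r hr ↦ ?_⟩
      rw [← Submodule.mem_bot R, ← h, pow_succ', Submodule.mul_smul]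
      exact Submodule.smul_mem_smul hr hy

theorem IsLocalRing.exists_surjective_to_residueField (R X : Type*) [CommRing R] [IsLocalRing R]
    [AddCommGroup X] [Module R X] [Module.Finite R X] [Nontrivial X] :
    ∃ f : X →ₗ[R] ResidueField R, Function.Surjective f := by
  have : Nontrivial (ResidueField R ⊗[R] X) := by
    rw [← not_subsingleton_iff_nontrivial, subsingleton_tensorProduct]
    exact not_subsingleton X
  obtain ⟨v, hv⟩ := exists_ne (0 : ResidueField R ⊗[R] X)
  obtain ⟨φ, hφ⟩ := not_forall.1 (mt (Module.forall_dual_apply_eq_zero_iff (ResidueField R) v).1 hv)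
  obtain ⟨x, rfl⟩ := TensorProduct.mk_surjective R X (ResidueField R) residue_surjective v
  let f : X →ₗ[R] ResidueField R := φ.restrictScalars R ∘ₗ TensorProduct.mk R (ResidueField R) X 1
  refine ⟨f, fun c ↦ ?_⟩
  obtain ⟨r, hr⟩ := residue_surjective (c * (f x)⁻¹)
  refine ⟨r • x, ?_⟩
  rw [map_smul, Algebra.smul_def]
  change residue R r * f x = c
  rw [hr]
  exact inv_mul_cancel_right₀ (b := f x) hφ c

theorem IsLocalRing.subsingleton_of_subsingleton_tensorProduct {R K X : Type*} [CommRing R]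
    [IsLocalRing R] [AddCommGroup K] [Module R K] [Module.Finite R K] [AddCommGroup X] [Module R X]
    [Module.Finite R X] [Nontrivial X] [Subsingleton (K ⊗[R] X)] : Subsingleton K := by
  obtain ⟨f, hf⟩ := exists_surjective_to_residueField R X
  have : Subsingleton (K ⊗[R] ResidueField R) :=
    (LinearMap.lTensor_surjective K hf).subsingleton
  exact subsingleton_tensorProduct.1
    (TensorProduct.comm R (ResidueField R) K).toEquiv.subsingleton

section Syzygy

variable {R : Type u} [CommRing R] [IsNoetherianRing R] [IsLocalRing R]
  {X : Type u} [AddCommGroup X] [Module R X] [Module.Finite R X] {n : ℕ}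
  (K : Submodule R (Fin n → R))

/-- If `K ⊆ 𝔪Rⁿ` and `K ⊗ X/𝔪N → (X/𝔪N)ⁿ` is injective, then `K ⊗ N → K ⊗ X` is zero. -/
theorem range_lTensor_subtype_eq_bot (hK : ∀ c ∈ K, ∀ j, c j ∈ maximalIdeal R)
    (N : Submodule R X)
    (h : Function.Injective (K.subtype.rTensor (X ⧸ (maximalIdeal R • N)))) :
    LinearMap.range (N.subtype.lTensor K) = ⊥ := by
  have hfg : (LinearMap.range (N.subtype.lTensor K)).FG :=
    Module.Finite.iff_fg.1 (Module.Finite.range _)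
  refine Submodule.eq_bot_of_le_smul_of_le_jacobson_bot (M := K ⊗[R] X) _ _ hfg ?_
    (maximalIdeal_le_jacobson _)
  set mN := maximalIdeal R • N
  have hle : LinearMap.range (N.subtype.lTensor K) ≤ LinearMap.range (mN.subtype.lTensor K) := by
    rw [← (lTensor_exact K (LinearMap.exact_subtype_mkQ mN)
      (Submodule.mkQ_surjective mN)).linearMap_ker_eq, LinearMap.range_le_ker_iff]
    refine TensorProduct.ext' fun c x ↦ h ?_
    have hc : (c : Fin n → R) = ∑ j, c.1 j • Pi.single j 1 := by
      simpa using (pi_eq_sum_univ' c.1)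
    simp only [LinearMap.comp_apply, LinearMap.lTensor_tmul, LinearMap.rTensor_tmul,
      Submodule.subtype_apply, LinearMap.zero_apply, map_zero]
    rw [hc, TensorProduct.sum_tmul]
    refine Finset.sum_eq_zero fun j _ ↦ ?_
    rw [TensorProduct.smul_tmul, ← map_smul, Submodule.mkQ_apply,
      (Submodule.Quotient.mk_eq_zero mN).2 (Submodule.smul_mem_smul (hK c c.2 j) x.2),
      TensorProduct.tmul_zero]
  refine hle.trans ?_
  rintro _ ⟨z, rfl⟩
  induction z with
  | zero => rw [map_zero]; exact zero_mem _
  | add a b ha hb => rw [map_add]; exact add_mem ha hb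
  | tmul c x =>
    obtain ⟨x, hx⟩ := x
    simp only [LinearMap.lTensor_tmul, Submodule.subtype_apply]
    induction hx using Submodule.smul_induction_on' with
    | smul r hr y hy =>
      rw [TensorProduct.tmul_smul]
      exact Submodule.smul_mem_smul hr ⟨c ⊗ₜ ⟨y, hy⟩, rfl⟩
    | add a ha b hb iha ihb =>
      rw [TensorProduct.tmul_add]
      exact add_mem iha ihb

theorem exists_socle_of_rTensor_injective [Nontrivial (K ⊗[R] X)]
    (hK : ∀ c ∈ K, ∀ j, c j ∈ maximalIdeal R)
    (N : Submodule R X) (hlen : IsFiniteLength R (X ⧸ N))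
    (h1 : Function.Injective (K.subtype.rTensor (X ⧸ (maximalIdeal R • N))))
    (h2 : Function.Injective (K.subtype.rTensor X)) :
    ∃ x : X, x ≠ 0 ∧ ∀ r ∈ maximalIdeal R, r • x = 0 := by
  obtain ⟨s, hs⟩ := hlen.exists_maximalIdeal_pow_smul_top_eq_bot
  have hzero := range_lTensor_subtype_eq_bot K hK N h1
  have hpow : maximalIdeal R ^ s • (⊤ : Submodule R (K ⊗[R] X)) = ⊥ := by
    rw [eq_bot_iff, Submodule.smul_le]
    intro r hr z _
    induction z with
    | zero => simp
    | add a b ha hb => rw [smul_add]; exact add_mem (ha trivial) (hb trivial)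
    | tmul c x =>
      have hx : r • x ∈ N := by
        rw [← Submodule.Quotient.mk_eq_zero, Submodule.Quotient.mk_smul, ← Submodule.mem_bot R,
          ← hs]
        exact Submodule.smul_mem_smul hr trivial
      rw [← hzero, ← TensorProduct.tmul_smul]
      exact ⟨c ⊗ₜ ⟨r • x, hx⟩, rfl⟩
  obtain ⟨y, hy, hym⟩ := exists_ne_zero_smul_eq_zero_of_pow_smul_top_eq_bot _ hpow
  let e : (Fin n → R) ⊗[R] X ≃ₗ[R] (Fin n → X) :=
    TensorProduct.comm R _ _ ≪≫ₗ TensorProduct.piScalarRight R R X (Fin n)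
  have hey : e (K.subtype.rTensor X y) ≠ 0 := by
    rw [ne_eq, e.map_eq_zero_iff, map_eq_zero_iff _ h2]
    exact hy
  obtain ⟨j, hj⟩ := Function.ne_iff.1 hey
  refine ⟨_, hj, fun r hr ↦ ?_⟩
  rw [← Pi.smul_apply, ← map_smul, ← map_smul, hym r hr, map_zero, map_zero, Pi.zero_apply]

end Syzygy

/-- Over a Noetherian local ring `(R, 𝔪)`, let `M`, `X` be finitely generated
with `X ≠ 0` and let `N` be a submodule of `X` with `X/N` of finite length. If `t ≥ 1` and
`Tor_t^R(M, X/𝔪N) = 0 = Tor_t^R(M, X)`, then either `depth_R X = 0` (i.e. the socle of `X` is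
nonzero) or `pd_R M < t`. -/
theorem tor_vanishing_quotient_mN_finite_length
    {R : Type u} [CommRing R] [IsNoetherianRing R] [IsLocalRing R]
    {M : Type u} [AddCommGroup M] [Module R M] [Module.Finite R M]
    {X : Type u} [AddCommGroup X] [Module R X] [Module.Finite R X]
    (hX : Nontrivial X)
    (N : Submodule R X) (hlen : IsFiniteLength R (X ⧸ N))
    (t : ℕ) (ht : 1 ≤ t)
    (h1 : TorIsZero R M (X ⧸ (IsLocalRing.maximalIdeal R • N)) t)
    (h2 : TorIsZero R M X t) :
    (∃ x : X, x ≠ 0 ∧ ∀ r ∈ IsLocalRing.maximalIdeal R, r • x = 0) ∨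
      HasProjDimLT R M t := by
  induction t, ht using Nat.le_induction generalizing M with
  | base =>
    obtain ⟨n, p, hp, hker⟩ := exists_surjective_forall_mem_ker_mem_maximalIdeal (R := R) (M := M)
    have hi := (LinearMap.ker p).subtype_injective
    have hip := p.exact_subtype_ker_map
    rcases subsingleton_or_nontrivial (LinearMap.ker p ⊗[R] X) with _ | _
    · right
      have hK : Subsingleton (LinearMap.ker p) :=
        subsingleton_of_subsingleton_tensorProduct (R := R) (X := X)
      have hinj : Function.Injective p :=
        LinearMap.ker_eq_bot.1 (Submodule.subsingleton_iff_eq_bot.1 hK)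
      have : Module.Projective R M := .of_equiv (LinearEquiv.ofBijective p ⟨hinj, hp⟩)
      exact .of_projective
    · exact .inl (exists_socle_of_rTensor_injective _ hker N hlen
        (h1.rTensor_injective hi hp hip) (h2.rTensor_injective hi hp hip))
  | succ t ht ih =>
    obtain ⟨n, p, hp⟩ := Module.Finite.exists_fin' R M
    have hi := (LinearMap.ker p).subtype_injective
    have hip := p.exact_subtype_ker_map
    obtain ⟨s, rfl⟩ : ∃ s, t = s + 1 := ⟨t - 1, by omega⟩
    exact (ih (h1.of_exact_of_flat hi hp hip) (h2.of_exact_of_flat hi hp hip)).imp_right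
      (.of_exact hi hp hip)
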